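/- Let K ⊂ ℝⁿ be an isotropic convex body with isotropy parameter M_K, and let (D_m)_{m≥1} be Borel subsets of ℝⁿ with D_m ⊂ K, |D_m| > 0, |D_m| → 0, such that K'_m := K \ D_m is a convex body for every m. Then there exist a constant C > 0 and m₀ such that for all m ≥ m₀: | (1/n!) ∫_{K'_m} ⋯ ∫_{K'_m} (det(X₁,…,Xₙ))² dX₁ ⋯ dXₙ − M_K^{2n} + M_K^{2(n−1)} ∫_{D_m} |X|² dX | ≤ C |K \ K'_m|². -/

import Mathlib

open MeasureTheory Metric Set Filter
open scoped InnerProductSpace Topology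

noncomputable section

/-- A convex body in ℝⁿ: a compact convex set with nonempty interior. -/
def IsConvexBody {n : ℕ} (K : Set (EuclideanSpace ℝ (Fin n))) : Prop :=
  IsCompact K ∧ Convex ℝ K ∧ (interior K).Nonempty

/-- The centroid of a set. -/
def centroid {n : ℕ} (K : Set (EuclideanSpace ℝ (Fin n))) : EuclideanSpace ℝ (Fin n) :=
  ((volume K).toReal)⁻¹ • ∫ x in K, x

/-- `(1/n!) ∫_{A}⋯∫_{A} det(X₁ − g, …, Xₙ − g)² dX₁ ⋯ dXₙ`. -/
def detInt {n : ℕ} (A : Set (EuclideanSpace ℝ (Fin n))) (g : EuclideanSpace ℝ (Fin n)) : ℝ :=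
  ((n.factorial : ℝ))⁻¹ *
    ∫ X in Set.univ.pi (fun _ : Fin n => A),
      (Matrix.det (Matrix.of fun i j : Fin n => X j i - g i)) ^ 2
      ∂(Measure.pi fun _ : Fin n => volume)

/-- `M_K^{2n}`, the 2n-th power of the isotropy parameter of a convex body. -/
def Mpow2n {n : ℕ} (K : Set (EuclideanSpace ℝ (Fin n))) : ℝ := detInt K (centroid K)

/-- The isotropy constant `L_K = M_K / |K|^{(n+2)/(2n)}` of a convex body. -/
def isoL (n : ℕ) (K : Set (EuclideanSpace ℝ (Fin n))) : ℝ :=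
  (Mpow2n K) ^ ((2 * (n : ℝ)))⁻¹ / (volume K).toReal ^ (((n : ℝ) + 2) / (2 * n))

/-- `K` is isotropic with isotropy parameter `M`. -/
def IsIsotropic {n : ℕ} (K : Set (EuclideanSpace ℝ (Fin n))) (M : ℝ) : Prop :=
  0 < M ∧ (∫ x in K, x) = 0 ∧
    ∀ y : EuclideanSpace ℝ (Fin n), (∫ x in K, (⟪x, y⟫_ℝ) ^ 2) = M ^ 2 * ‖y‖ ^ 2

/-- `(N, q)` witnesses positive generalized Gauss curvature of `K` at `X₀`. -/
def CurvWitness {n : ℕ} (K : Set (EuclideanSpace ℝ (Fin n))) (X₀ N : EuclideanSpace ℝ (Fin n))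
    (q : QuadraticForm ℝ (EuclideanSpace ℝ (Fin n))) : Prop :=
  ‖N‖ = 1 ∧ (∀ x ∈ K, 0 ≤ ⟪x - X₀, N⟫_ℝ) ∧
  (∀ Y : EuclideanSpace ℝ (Fin n), ⟪Y, N⟫_ℝ = 0 → Y ≠ 0 → 0 < q Y) ∧
  ∀ ε > (0 : ℝ), ∃ a > (0 : ℝ), ∀ (Y : EuclideanSpace ℝ (Fin n)) (y : ℝ), ⟪Y, N⟫_ℝ = 0 →
    X₀ + Y + y • N ∈ frontier K ∩ Metric.ball X₀ a →
    (1 - ε) * q Y ≤ y ∧ y ≤ (1 + ε) * q Y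

/-- `K` has positive generalized Gauss curvature at `X₀`. -/
def HasPosGenCurvature {n : ℕ} (K : Set (EuclideanSpace ℝ (Fin n)))
    (X₀ : EuclideanSpace ℝ (Fin n)) : Prop :=
  ∃ N q, CurvWitness K X₀ N q

/-- `K` is a local maximizer for the isotropy constant (Hausdorff distance). -/
def IsLocalMaxIso {n : ℕ} (K : Set (EuclideanSpace ℝ (Fin n))) : Prop :=
  ∃ ε > (0 : ℝ), ∀ K' : Set (EuclideanSpace ℝ (Fin n)), IsConvexBody K' →
    hausdorffDist K' K < ε → isoL n K' ≤ isoL n K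

/-- `K` is a local minimizer for the isotropy constant (Hausdorff distance). -/
def IsLocalMinIso {n : ℕ} (K : Set (EuclideanSpace ℝ (Fin n))) : Prop :=
  ∃ ε > (0 : ℝ), ∀ K' : Set (EuclideanSpace ℝ (Fin n)), IsConvexBody K' →
    hausdorffDist K' K < ε → isoL n K ≤ isoL n K'

/-- `X₀` is a point of local strict convexity of `∂K`. -/
def IsLocalStrictConvexPoint {n : ℕ} (K : Set (EuclideanSpace ℝ (Fin n)))
    (X₀ : EuclideanSpace ℝ (Fin n)) : Prop :=
  X₀ ∈ frontier K ∧
    ¬ ∃ A B : EuclideanSpace ℝ (Fin n), A ≠ B ∧ segment ℝ A B ⊆ frontier K ∧ X₀ ∈ segment ℝ A B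

/-- The matrix of second moments `∫_A xᵢ xⱼ dx`. -/
def secondMoment {n : ℕ} (A : Set (EuclideanSpace ℝ (Fin n))) : Matrix (Fin n) (Fin n) ℝ :=
  Matrix.of fun i j => ∫ x in A, x i * x j

lemma integrableOn_coord_mul_coord {n : ℕ} {K A : Set (EuclideanSpace ℝ (Fin n))}
    (hK : IsCompact K) (hA : A ⊆ K) (i j : Fin n) :
    IntegrableOn (fun x : EuclideanSpace ℝ (Fin n) => x i * x j) A := by
  have hc : Continuous fun x : EuclideanSpace ℝ (Fin n) => x i * x j := by fun_prop
  exact (hc.continuousOn.integrableOn_compact hK).mono_set hA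

/-- Andréief's identity for the coordinate functions. -/
lemma detInt_zero_eq_det_secondMoment {n : ℕ} {A : Set (EuclideanSpace ℝ (Fin n))}
    (hA : IsCompact A) : detInt A 0 = (secondMoment A).det := by
  have hsum : ∀ X : Fin n → EuclideanSpace ℝ (Fin n),
      (Matrix.det (Matrix.of fun i j : Fin n =>
        X j i - (0 : EuclideanSpace ℝ (Fin n)) i)) ^ 2 =
      ∑ σ : Equiv.Perm (Fin n), ∑ τ : Equiv.Perm (Fin n),
        ((Equiv.Perm.sign σ : ℤ) : ℝ) * ((Equiv.Perm.sign τ : ℤ) : ℝ) *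
          ∏ i, (X i (σ i) * X i (τ i)) := by
    intro X
    rw [sq, Matrix.det_apply', Finset.sum_mul_sum]
    refine Finset.sum_congr rfl fun σ _ => Finset.sum_congr rfl fun τ _ => ?_
    simp only [Matrix.of_apply, PiLp.zero_apply, sub_zero, Finset.prod_mul_distrib]
    ring
  have hint : ∀ σ τ : Equiv.Perm (Fin n),
      Integrable (fun X : Fin n → EuclideanSpace ℝ (Fin n) => ∏ i, (X i (σ i) * X i (τ i)))
        (Measure.pi fun _ : Fin n => volume.restrict A) := fun σ τ =>
    Integrable.fintype_prod (f := fun i (x : EuclideanSpace ℝ (Fin n)) => x (σ i) * x (τ i))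
      fun i => integrableOn_coord_mul_coord hA subset_rfl (σ i) (τ i)
  have hval : ∀ σ τ : Equiv.Perm (Fin n),
      ∫ X : Fin n → EuclideanSpace ℝ (Fin n), ∏ i, (X i (σ i) * X i (τ i))
        ∂(Measure.pi fun _ : Fin n => volume.restrict A) =
      ∏ i, secondMoment A (σ i) (τ i) := fun σ τ =>
    integral_fintype_prod_eq_prod
      (f := fun i (x : EuclideanSpace ℝ (Fin n)) => x (σ i) * x (τ i))
  have hrow : ∀ σ : Equiv.Perm (Fin n),
      ∑ τ : Equiv.Perm (Fin n), ((Equiv.Perm.sign σ : ℤ) : ℝ) * ((Equiv.Perm.sign τ : ℤ) : ℝ) *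
        ∏ i, secondMoment A (σ i) (τ i) = (secondMoment A).det := by
    intro σ
    have h1 : ((secondMoment A).submatrix σ id).transpose.det =
        ∑ τ : Equiv.Perm (Fin n), ((Equiv.Perm.sign τ : ℤ) : ℝ) *
          ∏ i, secondMoment A (σ i) (τ i) := by
      rw [Matrix.det_apply']; rfl
    rw [Matrix.det_transpose, Matrix.det_permute] at h1
    simp only [mul_assoc]
    rw [← Finset.mul_sum, ← h1, ← mul_assoc, ← Int.cast_mul, ← Units.val_mul, Int.units_mul_self]
    simp
  rw [detInt, Measure.restrict_pi_pi]
  simp only [hsum]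
  rw [integral_finsetSum _ fun σ _ => integrable_finsetSum _ fun τ _ =>
    (hint σ τ).const_mul _]
  have hn : (n.factorial : ℝ) ≠ 0 := by exact_mod_cast n.factorial_ne_zero
  have hinner : ∀ σ : Equiv.Perm (Fin n),
      ∫ X : Fin n → EuclideanSpace ℝ (Fin n), ∑ τ : Equiv.Perm (Fin n),
        ((Equiv.Perm.sign σ : ℤ) : ℝ) * ((Equiv.Perm.sign τ : ℤ) : ℝ) *
          ∏ i, (X i (σ i) * X i (τ i))
        ∂(Measure.pi fun _ : Fin n => volume.restrict A) = (secondMoment A).det := by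
    intro σ
    rw [integral_finsetSum _ fun τ _ => (hint σ τ).const_mul _]
    simp only [integral_const_mul, hval]
    exact hrow σ
  simp only [hinner, Finset.sum_const, Finset.card_univ, Fintype.card_perm, Fintype.card_fin,
    nsmul_eq_mul]
  field_simp

/-- Second order expansion of `det (1 + r F)`, uniform over bounded `r` and `F`. -/
lemma exists_abs_det_one_add_smul_sub_le (n : ℕ) (V R : ℝ) :
    ∃ c > (0 : ℝ), ∀ (r : ℝ) (F : Matrix (Fin n) (Fin n) ℝ), |r| ≤ V → (∀ i j, |F i j| ≤ R) →
      |(1 + r • F).det - (1 + r * F.trace)| ≤ c * r ^ 2 := by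
  let ι := Option (Fin n × Fin n)
  let G : Matrix (Fin n) (Fin n) (MvPolynomial ι ℝ) :=
    Matrix.of fun i j => MvPolynomial.X (some (i, j))
  let r₀ : MvPolynomial ι ℝ := MvPolynomial.X none
  obtain ⟨Q, hQ⟩ : ∃ Q, (1 + r₀ • G).det = 1 + G.trace * r₀ + Q * r₀ ^ 2 :=
    ⟨_, Matrix.det_one_add_smul r₀ G⟩
  have hcomp : IsCompact (Set.univ.pi fun _ : ι => Set.Icc (-(max V R)) (max V R)) :=
    isCompact_univ_pi fun _ => isCompact_Icc
  obtain ⟨C, hC⟩ := hcomp.exists_bound_of_continuousOn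
    (MvPolynomial.continuous_eval Q).continuousOn
  refine ⟨max C 1, by positivity, fun r F hr hF => ?_⟩
  let v : ι → ℝ := fun o => o.elim r fun p => F p.1 p.2
  have hv : v ∈ Set.univ.pi fun _ : ι => Set.Icc (-(max V R)) (max V R) := by
    rintro (_ | p) -
    · exact abs_le.mp (hr.trans (le_max_left _ _))
    · exact abs_le.mp ((hF p.1 p.2).trans (le_max_right _ _))
  have hmap : (MvPolynomial.eval v).mapMatrix (1 + r₀ • G) = 1 + r • F := by
    rw [map_add, map_one]
    congr 1
    ext i j
    simp [G, r₀, v]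
  have htr : MvPolynomial.eval v G.trace = F.trace := by
    simp [Matrix.trace, G, v]
  have h := congrArg (MvPolynomial.eval v) hQ
  rw [RingHom.map_det, hmap] at h
  simp only [map_add, map_mul, map_pow, map_one, htr] at h
  have hr₀ : MvPolynomial.eval v r₀ = r := by simp [r₀, v]
  rw [hr₀] at h
  have hrem : (1 + r • F).det - (1 + r * F.trace) = MvPolynomial.eval v Q * r ^ 2 := by
    rw [h]; ring
  rw [hrem, abs_mul, abs_of_nonneg (sq_nonneg r)]
  gcongr
  exact (hC v hv).trans (le_max_left _ _)

lemma IsIsotropic.secondMoment_eq {n : ℕ} {K : Set (EuclideanSpace ℝ (Fin n))} {M : ℝ}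
    (hK : IsCompact K) (hiso : IsIsotropic K M) :
    secondMoment K = (M ^ 2) • (1 : Matrix (Fin n) (Fin n) ℝ) := by
  obtain ⟨-, -, h⟩ := hiso
  have hdiag : ∀ i, ∫ x in K, x i * x i = M ^ 2 := fun i => by
    simpa [EuclideanSpace.inner_single_right, sq] using h (EuclideanSpace.single i 1)
  ext i j
  rw [Matrix.smul_apply, Matrix.one_apply]
  by_cases hij : i = j
  · subst hij
    simpa [secondMoment] using hdiag i
  · have hint := integrableOn_coord_mul_coord hK subset_rfl
    have hsum := h (EuclideanSpace.single i 1 + EuclideanSpace.single j 1)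
    have hnorm : ‖(EuclideanSpace.single i 1 + EuclideanSpace.single j 1 :
        EuclideanSpace ℝ (Fin n))‖ ^ 2 = 2 := by
      rw [norm_add_sq_real]
      simp [EuclideanSpace.inner_single_right, Ne.symm hij]
      norm_num
    have hexp : ∀ x : EuclideanSpace ℝ (Fin n),
        ⟪x, EuclideanSpace.single i 1 + EuclideanSpace.single j 1⟫_ℝ ^ 2 =
          (x i * x i + x j * x j) + 2 * (x i * x j) := fun x => by
      simp [inner_add_right, EuclideanSpace.inner_single_right]
      ring
    simp only [hexp, hnorm] at hsum
    rw [integral_add (f := fun x : EuclideanSpace ℝ (Fin n) => x i * x i + x j * x j)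
        ((hint i i).add (hint j j)) ((hint i j).const_mul 2),
      integral_add (hint i i) (hint j j), integral_const_mul, hdiag, hdiag] at hsum
    simp only [secondMoment, Matrix.of_apply, hij, if_false, smul_zero]
    linarith

lemma secondMoment_diff {n : ℕ} {K D : Set (EuclideanSpace ℝ (Fin n))}
    (hK : IsCompact K) (hD : MeasurableSet D) (hsub : D ⊆ K) :
    secondMoment (K \ D) = secondMoment K - secondMoment D := by
  ext i j
  exact setIntegral_sdiff hD (integrableOn_coord_mul_coord hK subset_rfl i j) hsub

lemma trace_secondMoment {n : ℕ} {K D : Set (EuclideanSpace ℝ (Fin n))}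
    (hK : IsCompact K) (hsub : D ⊆ K) :
    (secondMoment D).trace = ∫ x in D, ‖x‖ ^ 2 := by
  simp only [EuclideanSpace.real_norm_sq_eq]
  simp only [sq]
  rw [integral_finsetSum _ fun i _ => integrableOn_coord_mul_coord hK hsub i i]
  rfl

lemma exists_abs_secondMoment_le {n : ℕ} {K : Set (EuclideanSpace ℝ (Fin n))}
    (hK : IsCompact K) :
    ∃ R : ℝ, ∀ D ⊆ K, ∀ i j, |secondMoment D i j| ≤ R * (volume D).toReal := by
  obtain ⟨B, hB⟩ := hK.isBounded.exists_norm_le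
  refine ⟨B * B, fun D hD i j => ?_⟩
  change ‖∫ x in D, x i * x j‖ ≤ B * B * volume.real D
  refine norm_setIntegral_le_of_norm_le_const
    ((measure_mono hD).trans_lt hK.measure_lt_top) fun x hx => ?_
  rw [norm_mul]
  have hx' := hB x (hD hx)
  exact mul_le_mul ((PiLp.norm_apply_le x i).trans hx') ((PiLp.norm_apply_le x j).trans hx')
    (norm_nonneg _) ((norm_nonneg x).trans hx')

/-- **Lemma 2 (Meyer–Reisner).** Effect of removing small sets `D m` from an isotropic
convex body on the iterated determinant integral. -/
theorem detInt_diff_inner_sets {n : ℕ} (K : Set (EuclideanSpace ℝ (Fin n))) (M : ℝ)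
    (hK : IsConvexBody K) (hiso : IsIsotropic K M)
    (D : ℕ → Set (EuclideanSpace ℝ (Fin n)))
    (hmeas : ∀ m, MeasurableSet (D m))
    (hsub : ∀ m, D m ⊆ K)
    (hpos : ∀ m, 0 < volume (D m))
    (hto0 : Tendsto (fun m => volume (D m)) atTop (𝓝 0))
    (hconv : ∀ m, IsConvexBody (K \ D m)) :
    ∃ c > (0 : ℝ), ∃ m₀ : ℕ, ∀ m ≥ m₀,
      |detInt (K \ D m) 0 - M ^ (2 * n)
          + M ^ (2 * (n - 1)) * ∫ x in D m, ‖x‖ ^ 2|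
        ≤ c * ((volume (K \ (K \ D m))).toReal) ^ 2 := by
  obtain ⟨hKc, -, -⟩ := hK
  have hM : 0 < M := hiso.1
  obtain ⟨R, hR⟩ := exists_abs_secondMoment_le hKc
  obtain ⟨c, hc, hdet⟩ := exists_abs_det_one_add_smul_sub_le n (volume K).toReal (R / M ^ 2)
  refine ⟨M ^ (2 * n) * c, by positivity, 0, fun m _ => ?_⟩
  have hKfin : volume K ≠ ⊤ := hKc.measure_lt_top.ne
  have hDfin : volume (D m) ≠ ⊤ := ne_top_of_le_ne_top hKfin (measure_mono (hsub m))
  have hv : 0 < (volume (D m)).toReal := ENNReal.toReal_pos (hpos m).ne' hDfin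
  rw [sdiff_sdiff_cancel_left (hsub m), detInt_zero_eq_det_secondMoment (hconv m).1,
    secondMoment_diff hKc (hmeas m) (hsub m), hiso.secondMoment_eq hKc,
    ← trace_secondMoment hKc (hsub m)]
  have hvK : (volume (D m)).toReal ≤ (volume K).toReal :=
    ENNReal.toReal_mono hKfin (measure_mono (hsub m))
  have hE := hR (D m) (hsub m)
  generalize secondMoment (D m) = E at hE ⊢
  generalize (volume (D m)).toReal = v at hv hvK hE ⊢
  let F : Matrix (Fin n) (Fin n) ℝ := (-(v * M ^ 2)⁻¹) • E
  have hF : ∀ i j, |F i j| ≤ R / M ^ 2 := fun i j => by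
    have hvM : 0 < v * M ^ 2 := by positivity
    rw [show F i j = -(v * M ^ 2)⁻¹ * E i j from rfl, abs_mul, abs_neg, abs_of_pos (inv_pos.mpr hvM),
      inv_mul_le_iff₀ hvM]
    refine (hE i j).trans (le_of_eq ?_)
    field_simp
  have hsplit : (M ^ 2) • (1 : Matrix (Fin n) (Fin n) ℝ) - E = (M ^ 2) • (1 + v • F) := by
    rw [smul_add, smul_smul, smul_smul, sub_eq_add_neg]
    congr 1
    rw [show M ^ 2 * v * -(v * M ^ 2)⁻¹ = -1 by field_simp, neg_one_smul]
  have htr : M ^ (2 * (n - 1)) * E.trace = -(M ^ (2 * n) * (v * F.trace)) := by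
    rcases n.eq_zero_or_pos with rfl | hn
    · simp [Matrix.trace]
    · obtain ⟨k, rfl⟩ := Nat.exists_eq_add_of_le' hn
      simp only [F, Matrix.trace_smul, smul_eq_mul, Nat.add_sub_cancel]
      field_simp
      ring
  have hrem := hdet v F (by rwa [abs_of_pos hv]) hF
  rw [hsplit, Matrix.det_smul, Fintype.card_fin, ← pow_mul, htr]
  calc _ = |M ^ (2 * n) * ((1 + v • F).det - (1 + v * F.trace))| := by congr 1; ring
    _ = M ^ (2 * n) * |(1 + v • F).det - (1 + v * F.trace)| := by
      rw [abs_mul, abs_of_pos (by positivity)]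
    _ ≤ M ^ (2 * n) * (c * v ^ 2) := by gcongr
    _ = _ := by ring
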